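/- Let (Ω, d, F) be a filtered cochain complex over a field k. Then for every r ≥ 0 and all integers p, q there is a k-linear isomorphism E_{r+1}^{p,q} ≅ ker(s_r : E_r^{p,q} → E_r^{p+1−r,q+r}) / im(s_r : E_r^{p+r−1,q−r} → E_r^{p,q}); that is, each page of the spectral sequence is the cohomology of the previous page with respect to the induced differential. -/

import Mathlib

/-- A filtered cochain complex `(Ω, d, F)` over a field `k`, realized inside an ambient
`k`-vector space `V`: the degree-`n` piece `Ω n` and the filtration pieces `F q n ⊆ Ω n`
are subspaces of `V`, and the differential `d` is a linear map which raises the degree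
by one, squares to zero, and preserves the filtration. -/
structure FilteredComplex (k V : Type*) [Field k] [AddCommGroup V] [Module k V] where
  /-- the degree `n` component `Ω^n` -/
  Ω : ℤ → Submodule k V
  /-- the differential `d` -/
  d : V →ₗ[k] V
  d_sq : ∀ x : V, d (d x) = 0
  d_deg : ∀ n : ℤ, (Ω n).map d ≤ Ω (n + 1)
  /-- the decreasing filtration `F^q Ω^n` -/
  F : ℤ → ℤ → Submodule k V
  F_le : ∀ q n : ℤ, F q n ≤ Ω n
  F_antitone : ∀ q n : ℤ, F (q + 1) n ≤ F q n
  d_F : ∀ q n : ℤ, (F q n).map d ≤ F q (n + 1)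

namespace FilteredComplex

variable {k V : Type*} [Field k] [AddCommGroup V] [Module k V]

/-- The generalized cocycles `Z_r^{p,q} = {x ∈ F^q Ω^{p+q} : d x ∈ F^{q+r} Ω^{p+q+1}}`. -/
def Z (C : FilteredComplex k V) (r p q : ℤ) : Submodule k V :=
  C.F q (p + q) ⊓ (C.F (q + r) (p + q + 1)).comap C.d

/-- The generalized coboundaries `B_r^{p,q} = F^q Ω^{p+q} ∩ d(F^{q-r} Ω^{p+q-1})`. -/
def B (C : FilteredComplex k V) (r p q : ℤ) : Submodule k V :=
  C.F q (p + q) ⊓ (C.F (q - r) (p + q - 1)).map C.d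

/-- `Z_∞^{p,q} = F^q Ω^{p+q} ∩ ker (d : Ω^{p+q} → Ω^{p+q+1})`. -/
def Zinf (C : FilteredComplex k V) (p q : ℤ) : Submodule k V :=
  C.F q (p + q) ⊓ LinearMap.ker C.d

/-- `B_∞^{p,q} = F^q Ω^{p+q} ∩ d(Ω^{p+q-1})`. -/
def Binf (C : FilteredComplex k V) (p q : ℤ) : Submodule k V :=
  C.F q (p + q) ⊓ (C.Ω (p + q - 1)).map C.d

/-- The spectral sequence page `E_r^{p,q} = Z_r^{p,q} / (Z_{r-1}^{p-1,q+1} + B_{r-1}^{p,q})`. -/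
abbrev Epage (C : FilteredComplex k V) (r p q : ℤ) :=
  C.Z r p q ⧸ ((C.Z (r - 1) (p - 1) (q + 1) ⊔ C.B (r - 1) p q).comap (C.Z r p q).subtype)

/-- The limit page `E_∞^{p,q} = Z_∞^{p,q} / (Z_∞^{p-1,q+1} + B_∞^{p,q})`. -/
abbrev Einf (C : FilteredComplex k V) (p q : ℤ) :=
  C.Zinf p q ⧸ ((C.Zinf (p - 1) (q + 1) ⊔ C.Binf p q).comap (C.Zinf p q).subtype)

/-- The filtered cohomology `F^q H^n = (F^q Ω^n ∩ ker d) / (F^q Ω^n ∩ d(Ω^{n-1}))`. -/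
abbrev FH (C : FilteredComplex k V) (q n : ℤ) :=
  ↥(C.F q n ⊓ LinearMap.ker C.d) ⧸
    ((C.F q n ⊓ (C.Ω (n - 1)).map C.d).comap (C.F q n ⊓ LinearMap.ker C.d).subtype)

/-- The cohomology `H^n(Ω; d) = ker(d : Ω^n → Ω^{n+1}) / d(Ω^{n-1})`. -/
abbrev Hcoh (C : FilteredComplex k V) (n : ℤ) :=
  ↥(C.Ω n ⊓ LinearMap.ker C.d) ⧸
    (((C.Ω (n - 1)).map C.d).comap (C.Ω n ⊓ LinearMap.ker C.d).subtype)

/-- The filtration is bounded with constant `N ≥ 0` if, in every degree `n`,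
`F^q Ω^n = 0` for `q > 0` and `F^q Ω^n = Ω^n` for `q ≤ -N`. -/
def IsBounded (C : FilteredComplex k V) (N : ℕ) : Prop :=
  (∀ q n : ℤ, 0 < q → C.F q n = ⊥) ∧ (∀ q n : ℤ, q ≤ -(N : ℤ) → C.F q n = C.Ω n)

end FilteredComplex

theorem ssZ_iff {k V : Type*} [Field k] [AddCommGroup V] [Module k V]
    (C : FilteredComplex k V) {r p q : ℤ} (n s : ℤ) (hn : p + q = n) (hs : q + r = s) (x : V) :
    x ∈ C.Z r p q ↔ x ∈ C.F q n ∧ C.d x ∈ C.F s (n + 1) := by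
  subst hn hs
  rfl

theorem ssB_iff {k V : Type*} [Field k] [AddCommGroup V] [Module k V]
    (C : FilteredComplex k V) {r p q : ℤ} (n m s : ℤ) (hn : p + q = n) (hm : p + q - 1 = m)
    (hs : q - r = s) (x : V) :
    x ∈ C.B r p q ↔ x ∈ C.F q n ∧ ∃ w ∈ C.F s m, C.d w = x := by
  subst hn hm hs
  rfl

theorem ssF_mono {k V : Type*} [Field k] [AddCommGroup V] [Module k V]
    (C : FilteredComplex k V) (q s n : ℤ) (h : s = q + 1) (x : V) (hx : x ∈ C.F s n) :
    x ∈ C.F q n := by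
  subst h
  exact C.F_antitone q n hx

theorem ssE_eq {k V : Type*} [Field k] [AddCommGroup V] [Module k V]
    (C : FilteredComplex k V) {r p q : ℤ} (x y : C.Z r p q) :
    ((Submodule.Quotient.mk x : C.Epage r p q) = Submodule.Quotient.mk y) ↔
      (x : V) - y ∈ C.Z (r - 1) (p - 1) (q + 1) ⊔ C.B (r - 1) p q := by
  rw [Submodule.Quotient.eq]
  rfl

/-- For a filtered cochain complex over a field `k`, for every `r ≥ 0`
and all integers `p, q`, there is a `k`-linear isomorphism
`E_{r+1}^{p,q} ≅ ker(s_r : E_r^{p,q} → E_r^{p+1-r,q+r}) / im(s_r : E_r^{p+r-1,q-r} → E_r^{p,q})`: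
each page of the spectral sequence is the cohomology of the previous page with respect to
the induced differential (the maps `f` and `g` below are the two relevant instances of
`s_r`, characterized by `s_r [x] = [d x]`). -/
theorem secondary_qhr_statement2 {k V : Type*} [Field k] [AddCommGroup V] [Module k V]
    (C : FilteredComplex k V) (r p q : ℤ) (hr : 0 ≤ r)
    (f : C.Epage r (p + r - 1) (q - r) →ₗ[k] C.Epage r p q)
    (g : C.Epage r p q →ₗ[k] C.Epage r (p + 1 - r) (q + r))
    (hf : ∀ (x : V) (hx : x ∈ C.Z r (p + r - 1) (q - r)) (hdx : C.d x ∈ C.Z r p q),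
      f (Submodule.Quotient.mk ⟨x, hx⟩) = Submodule.Quotient.mk ⟨C.d x, hdx⟩)
    (hg : ∀ (x : V) (hx : x ∈ C.Z r p q) (hdx : C.d x ∈ C.Z r (p + 1 - r) (q + r)),
      g (Submodule.Quotient.mk ⟨x, hx⟩) = Submodule.Quotient.mk ⟨C.d x, hdx⟩) :
    Nonempty (C.Epage (r + 1) p q ≃ₗ[k]
      LinearMap.ker g ⧸ ((LinearMap.range f).comap (LinearMap.ker g).subtype)) := by
  have hle : C.Z (r + 1) p q ≤ C.Z r p q := by
    intro x hx
    rw [ssZ_iff C (p + q) (q + r + 1) rfl (by ring)] at hx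
    rw [ssZ_iff C (p + q) (q + r) rfl rfl]
    exact ⟨hx.1, ssF_mono C _ _ _ rfl _ hx.2⟩
  -- the differential lands in the right place
  have hdZ : ∀ x ∈ C.Z r p q, C.d x ∈ C.Z r (p + 1 - r) (q + r) := by
    intro x hx
    rw [ssZ_iff C (p + q) (q + r) rfl rfl] at hx
    rw [ssZ_iff C (p + q + 1) (q + r + r) (by ring) rfl, C.d_sq]
    exact ⟨hx.2, Submodule.zero_mem _⟩
  have hdZ' : ∀ x ∈ C.Z r (p + r - 1) (q - r), C.d x ∈ C.Z r p q := by
    intro x hx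
    rw [ssZ_iff C (p + q - 1) q (by ring) (by ring)] at hx
    rw [ssZ_iff C (p + q - 1 + 1) (q + r) (by ring) rfl, C.d_sq]
    exact ⟨hx.2, Submodule.zero_mem _⟩
  -- classes of elements of `Z (r+1)` are killed by `g`
  have hker : ∀ x : C.Z (r + 1) p q,
      (Submodule.Quotient.mk (Submodule.inclusion hle x) : C.Epage r p q) ∈ LinearMap.ker g := by
    rintro ⟨x, hx⟩
    rw [LinearMap.mem_ker]
    refine (hg x (hle hx) (hdZ x (hle hx))).trans ?_
    rw [Submodule.Quotient.mk_eq_zero, Submodule.mem_comap]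
    refine Submodule.mem_sup_left ?_
    rw [ssZ_iff C (p + q) (q + r + 1) rfl (by ring)] at hx
    change C.d x ∈ _
    rw [ssZ_iff C (p + q + 1) (q + r + r) (by ring) (by ring), C.d_sq]
    exact ⟨hx.2, Submodule.zero_mem _⟩
  let φ₀ : C.Z (r + 1) p q →ₗ[k] LinearMap.ker g :=
    LinearMap.codRestrict (LinearMap.ker g)
      ((Submodule.mkQ ((C.Z (r - 1) (p - 1) (q + 1) ⊔ C.B (r - 1) p q).comap
        (C.Z r p q).subtype)).comp (Submodule.inclusion hle)) hker
  let φ : C.Z (r + 1) p q →ₗ[k]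
      LinearMap.ker g ⧸ ((LinearMap.range f).comap (LinearMap.ker g).subtype) :=
    (Submodule.mkQ _).comp φ₀
  have hsurj : Function.Surjective φ := by
    have h0 : Function.Surjective φ₀ := by
      rintro ⟨e, he⟩
      obtain ⟨⟨y, hy⟩, rfl⟩ := Submodule.Quotient.mk_surjective _ e
      rw [LinearMap.mem_ker, hg y hy (hdZ y hy), Submodule.Quotient.mk_eq_zero,
        Submodule.mem_comap] at he
      obtain ⟨a, ha, b, hb, hab⟩ := Submodule.mem_sup.1 he
      change a + b = C.d y at hab
      rw [ssZ_iff C (p + q + 1) (q + r + r) (by ring) (by ring)] at ha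
      rw [ssB_iff C (p + q + 1) (p + q) (q + 1) (by ring) (by ring) (by ring)] at hb
      obtain ⟨hb1, c, hc, rfl⟩ := hb
      have hy' := hy
      rw [ssZ_iff C (p + q) (q + r) rfl rfl] at hy'
      have hz : y - c ∈ C.Z (r + 1) p q := by
        rw [ssZ_iff C (p + q) (q + r + 1) rfl (by ring)]
        refine ⟨Submodule.sub_mem _ hy'.1 (ssF_mono C _ _ _ rfl _ hc), ?_⟩
        rw [map_sub, ← hab, add_sub_cancel_right]
        exact ha.1
      refine ⟨⟨y - c, hz⟩, Subtype.ext ?_⟩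
      refine (ssE_eq C ⟨y - c, hle hz⟩ ⟨y, hy⟩).2 (Submodule.mem_sup_left ?_)
      change y - c - y ∈ _
      rw [sub_sub_cancel_left]
      refine Submodule.neg_mem _ ?_
      rw [ssZ_iff C (p + q) (q + r) (by ring) (by ring)]
      exact ⟨hc, hb1⟩
    exact (Submodule.mkQ_surjective _).comp h0
  have hkerφ : LinearMap.ker φ =
      (C.Z (r + 1 - 1) (p - 1) (q + 1) ⊔ C.B (r + 1 - 1) p q).comap
        (C.Z (r + 1) p q).subtype := by
    ext ⟨x, hx⟩
    have h1 : (⟨x, hx⟩ : C.Z (r + 1) p q) ∈ LinearMap.ker φ ↔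
        (Submodule.Quotient.mk ⟨x, hle hx⟩ : C.Epage r p q) ∈ LinearMap.range f := by
      rw [LinearMap.mem_ker]
      change (Submodule.Quotient.mk _ = (0 : _ ⧸ _)) ↔ _
      rw [Submodule.Quotient.mk_eq_zero]
      rfl
    rw [h1, Submodule.mem_comap]
    change _ ↔ x ∈ _
    have hx' := hx
    rw [ssZ_iff C (p + q) (q + r + 1) rfl (by ring)] at hx'
    constructor
    · rintro ⟨e, he⟩
      obtain ⟨⟨z, hz⟩, rfl⟩ := Submodule.Quotient.mk_surjective _ e
      rw [hf z hz (hdZ' z hz)] at he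
      have he' := (ssE_eq C _ _).1 he.symm
      change x - C.d z ∈ _ at he'
      obtain ⟨u, hu, b, hb, hub⟩ := Submodule.mem_sup.1 he'
      rw [ssZ_iff C (p + q) (q + r) (by ring) (by ring)] at hu
      rw [ssB_iff C (p + q) (p + q - 1) (q - r + 1) rfl rfl (by ring)] at hb
      obtain ⟨hb1, w, hw, rfl⟩ := hb
      rw [ssZ_iff C (p + q - 1) q (by ring) (by ring), sub_add_cancel] at hz
      have hxe : x = u + C.d (z + w) := by
        rw [map_add, add_left_comm, hub]
        abel
      refine Submodule.mem_sup.2 ⟨u, ?_, C.d (z + w), ?_, hxe.symm⟩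
      · rw [ssZ_iff C (p + q) (q + r + 1) (by ring) (by ring)]
        refine ⟨hu.1, ?_⟩
        have : C.d u = C.d x := by rw [hxe, map_add, C.d_sq, add_zero]
        rw [this]
        exact hx'.2
      · rw [ssB_iff C (p + q) (p + q - 1) (q - r) rfl rfl (by ring)]
        refine ⟨?_, z + w, Submodule.add_mem _ hz.1 (ssF_mono C _ _ _ rfl _ hw), rfl⟩
        rw [map_add]
        exact Submodule.add_mem _ hz.2 hb1
    · intro h
      obtain ⟨u, hu, b, hb, hub⟩ := Submodule.mem_sup.1 h
      rw [ssZ_iff C (p + q) (q + r + 1) (by ring) (by ring)] at hu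
      rw [ssB_iff C (p + q) (p + q - 1) (q - r) rfl rfl (by ring)] at hb
      obtain ⟨hb1, w, hw, rfl⟩ := hb
      have hwZ : w ∈ C.Z r (p + r - 1) (q - r) := by
        rw [ssZ_iff C (p + q - 1) q (by ring) (by ring), sub_add_cancel]
        exact ⟨hw, hb1⟩
      refine ⟨Submodule.Quotient.mk ⟨w, hwZ⟩, ?_⟩
      rw [hf w hwZ (hdZ' w hwZ)]
      symm
      refine (ssE_eq C _ _).2 (Submodule.mem_sup_left ?_)
      change x - C.d w ∈ _
      rw [← hub, add_sub_cancel_right, ssZ_iff C (p + q) (q + r) (by ring) (by ring)]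
      exact ⟨hu.1, ssF_mono C _ _ _ rfl _ hu.2⟩
  exact ⟨(Submodule.quotEquivOfEq _ _ hkerφ.symm).trans (φ.quotKerEquivOfSurjective hsurj)⟩
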